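/- Let H be a connected graph with minimum degree d, where d > 2. Then there exists a subset V' ⊆ V(H) with |V'| = d such that both the induced subgraph H[V'] and the induced subgraph H[V(H) \ V'] are connected. -/

import Mathlib

open SimpleGraph

attribute [local instance] Classical.propDecidable

section aux
variable {V : Type*} [Fintype V] (H : SimpleGraph V)

theorem aux_boundary {S T : Set V} (hS : (H.induce S).Connected) (hTS : T ⊆ S)
    {x y : V} (hx : x ∈ T) (hy : y ∈ S) (hyT : y ∉ T) :
    ∃ u ∈ T, ∃ v ∈ S, v ∉ T ∧ H.Adj u v := by
  obtain ⟨p⟩ := hS.preconnected ⟨x, hTS hx⟩ ⟨y, hy⟩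
  obtain ⟨e, -, h1, h2⟩ := p.exists_boundary_dart {z | z.1 ∈ T} hx hyT
  exact ⟨e.fst.1, h1, e.snd.1, e.snd.2, h2, e.adj⟩

theorem aux_union {S T : Set V} (hS : (H.induce S).Connected) (hT : (H.induce T).Connected)
    {u v : V} (hu : u ∈ S) (hv : v ∈ T) (h : H.Adj u v) : (H.induce (S ∪ T)).Connected := by
  have h1 := induce_union_connected hS.preconnected
    (induce_pair_connected_of_adj h).preconnected ⟨u, hu, Or.inl rfl⟩
  have h2 := induce_union_connected h1.preconnected hT.preconnected ⟨v, Or.inr (Or.inr rfl), hv⟩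
  have h3 : S ∪ {u, v} ∪ T = S ∪ T := by
    ext z
    simp only [Set.mem_union, Set.mem_insert_iff, Set.mem_singleton_iff]
    constructor
    · rintro ((h | rfl | rfl) | h) <;> tauto
    · tauto
  rwa [h3] at h2

theorem aux_single (x : V) : (H.induce {x}).Connected := by
  haveI : Nonempty ({x} : Set V) := ⟨⟨x, rfl⟩⟩
  haveI : Subsingleton ({x} : Set V) := inferInstance
  exact ⟨Preconnected.of_subsingleton⟩

theorem aux_comp (S : Set V) {x : V} (hx : x ∈ S) :
    ∃ D ⊆ S, x ∈ D ∧ (H.induce D).Connected ∧ ∀ u ∈ D, ∀ v ∈ S, H.Adj u v → v ∈ D := by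
  obtain ⟨D, hD⟩ := (Set.toFinite {D : Set V | D ⊆ S ∧ x ∈ D ∧ (H.induce D).Connected}).exists_maximal
    ⟨{x}, by simpa using hx, rfl, aux_single H x⟩
  obtain ⟨h1, h2, h3⟩ := hD.prop
  refine ⟨D, h1, h2, h3, fun u hu v hv huv => ?_⟩
  have := hD.le_of_ge (y := D ∪ {v}) ⟨Set.union_subset h1 (by simpa using hv), Or.inl h2,
    aux_union H h3 (aux_single H v) hu rfl huv⟩ (Set.subset_union_left)
  exact this (Or.inr rfl)

theorem aux_diff {X D : Set V} {a : V} (hX : (H.induce X).Connected) (ha : a ∈ X) (haD : a ∉ D)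
    (hDX : D ⊆ X) (hcl : ∀ u ∈ D, ∀ v ∈ X, v ≠ a → H.Adj u v → v ∈ D) :
    (H.induce (X \ D)).Connected := by
  obtain ⟨C, hC, haC, hCc, hCcl⟩ := aux_comp H (X \ D) (x := a) ⟨ha, haD⟩
  have : C = X \ D := by
    refine hC.antisymm fun y hy => ?_
    by_contra hyC
    obtain ⟨u, hu, v, hv, hvn, huv⟩ := aux_boundary H hX (T := C ∪ D)
      (Set.union_subset (fun z hz => (hC hz).1) hDX) (Or.inl haC) hy.1
      (by rintro (h | h); exacts [hyC h, hy.2 h])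
    have hvC : v ∉ C := fun h => hvn (Or.inl h)
    have hvD : v ∉ D := fun h => hvn (Or.inr h)
    rcases hu with hu | hu
    · exact hvC (hCcl u hu v ⟨hv, hvD⟩ huv)
    · exact hvD (hcl u hu v hv (fun h => hvC (h ▸ haC)) huv)
  exact this ▸ hCc

end aux

theorem stmt4 {V : Type*} [Fintype V] [Nonempty V] (H : SimpleGraph V)
    (hconn : H.Connected) (d : ℕ) (hd : 2 < d) (hmin : H.minDegree = d) :
    ∃ V' : Finset V, V'.card = d ∧ (H.induce (V' : Set V)).Connected ∧
      (H.induce ((V' : Set V)ᶜ)).Connected := by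
  have hU : (H.induce (Set.univ : Set V)).Connected :=
    (induceUnivIso H).connected_iff.2 hconn
  have hcard : d < Fintype.card V := hmin ▸ H.minDegree_lt_card
  have hex : ∃ M : Set V, (H.induce M).Connected ∧ (H.induce Mᶜ).Connected ∧ d ≤ M.ncard := by
    obtain ⟨v, hv⟩ := hconn.exists_preconnected_induce_compl_singleton_of_finite
    have hc : ({v}ᶜ : Set V).ncard = Fintype.card V - 1 := by
      rw [Set.ncard_compl, Set.ncard_singleton, Nat.card_eq_fintype_card]
    have hne : ({v}ᶜ : Set V).Nonempty := Set.nonempty_of_ncard_ne_zero (by omega)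
    haveI := hne.to_subtype
    exact ⟨{v}ᶜ, ⟨hv⟩, by rw [compl_compl]; exact aux_single H v, by omega⟩
  obtain ⟨M, ⟨hM, hMc, hMd⟩, hMmin⟩ := (Set.toFinite {M : Set V | (H.induce M).Connected ∧
    (H.induce Mᶜ).Connected ∧ d ≤ M.ncard}).exists_minimalFor Set.ncard _ hex
  rcases hMd.eq_or_lt with h | hlt
  · refine ⟨M.toFinset, ?_, by rw [Set.coe_toFinset]; exact hM,
      by rw [Set.coe_toFinset]; exact hMc⟩
    rw [h, Set.ncard_eq_toFinset_card']
  exfalso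
  let P : V × Set V → Prop := fun q => q.1 ∈ M ∧ (∃ k ∉ M, H.Adj q.1 k) ∧ q.2 ⊆ M \ {q.1} ∧
    (H.induce q.2).Connected ∧ ∀ u ∈ q.2, ∀ v ∈ M \ {q.1}, H.Adj u v → v ∈ q.2
  have hA : ∀ a D, P (a, D) → D.ncard < d := by
    rintro a D ⟨ha, ⟨k, hk, hak⟩, hD, hDc, hcl⟩
    dsimp only at *
    by_contra hge
    have haD : a ∉ D := fun h => (hD h).2 rfl
    have h1 : (H.induce (M \ D)).Connected := aux_diff H hM ha haD (fun z hz => (hD hz).1)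
      (fun u hu v hv hva => hcl u hu v ⟨hv, hva⟩)
    have h2 := aux_union H h1 hMc (u := a) (v := k) ⟨ha, haD⟩ hk hak
    have h3 : M \ D ∪ Mᶜ = Dᶜ := by
      ext z
      have := @hD z
      simp only [Set.mem_union, Set.mem_diff, Set.mem_compl_iff, Set.mem_singleton_iff] at *
      tauto
    rw [h3] at h2
    have hlt' : D.ncard < M.ncard := Set.ncard_lt_ncard
      ⟨fun z hz => (hD hz).1, fun h => haD (h ha)⟩
    have := hMmin (j := D) ⟨hDc, h2, by omega⟩ hlt'.le
    omega
  have hB : ∀ a D, P (a, D) → ∃ a' ∈ D, ∃ k ∉ M, H.Adj a' k := by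
    intro a D hP
    have hlt := hA a D hP
    obtain ⟨ha, -, hD, hDc, hcl⟩ := hP
    dsimp only at *
    by_contra hno
    push Not at hno
    obtain ⟨⟨x, hx⟩⟩ := hDc.nonempty
    have hdeg : d ≤ H.degree x := hmin ▸ H.minDegree_le_degree x
    have hsub : H.neighborSet x ⊆ insert a (D \ {x}) := by
      intro y hy
      have hxy : H.Adj x y := hy
      by_cases hya : y = a
      · exact Or.inl hya
      · have hyM : y ∈ M := by
          by_contra h
          exact hno x hx y h hxy
        exact Or.inr ⟨hcl x hx y ⟨hyM, hya⟩ hxy, fun h => hxy.ne h.symm⟩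
    have h1 := Set.ncard_le_ncard hsub
    have h2 := Set.ncard_insert_le a (D \ {x})
    have h3 := Set.ncard_diff_singleton_add_one hx
    have h4 : (H.neighborSet x).ncard = H.degree x := by
      rw [Set.ncard_eq_toFinset_card', ← card_neighborFinset_eq_degree]; rfl
    omega
  have hP0 : ∃ q, P q := by
    obtain ⟨⟨m, hm⟩⟩ := hM.nonempty
    obtain ⟨⟨k, hk⟩⟩ := hMc.nonempty
    obtain ⟨a, ha, v, -, hv, hav⟩ := aux_boundary H hU (Set.subset_univ M) hm (Set.mem_univ k) hk
    obtain ⟨x, hx, hxa⟩ := Set.exists_ne_of_one_lt_ncard (s := M) (by omega) a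
    obtain ⟨D, h1, -, h2, h3⟩ := aux_comp H (M \ {a}) (x := x) ⟨hx, hxa⟩
    exact ⟨(a, D), ha, ⟨v, hv, hav⟩, h1, h2, h3⟩
  obtain ⟨⟨a, D⟩, hP, hmin'⟩ := (Set.toFinite {q | P q}).exists_minimalFor
    (fun q => q.2.ncard) _ hP0
  obtain ⟨a', ha'D, k, hk, hak⟩ := hB a D hP
  obtain ⟨ha, -, hD, hDc, hcl⟩ := hP
  dsimp only at *
  have ha'M : a' ∈ M := (hD ha'D).1
  have haD : a ∉ D := fun h => (hD h).2 rfl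
  have haa' : a ≠ a' := fun h => haD (h ▸ ha'D)
  obtain ⟨E, hE1, haE, hE2, hE3⟩ := aux_comp H (M \ {a'}) (x := a) ⟨ha, haa'⟩
  have hEd := hA a' E ⟨ha'M, ⟨k, hk, hak⟩, hE1, hE2, hE3⟩
  have hMa := Set.ncard_diff_singleton_add_one ha'M
  obtain ⟨x, hx, hxE⟩ := Set.exists_mem_notMem_of_ncard_lt_ncard (s := E) (t := M \ {a'}) (by omega)
  obtain ⟨F, hF1, hxF, hF2, hF3⟩ := aux_comp H (M \ {a'}) hx
  have haF : a ∉ F := by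
    intro haF
    obtain ⟨u, hu, v, hv, hvn, huv⟩ := aux_boundary H hF2 (T := F ∩ E) Set.inter_subset_left
      (x := a) (y := x) ⟨haF, haE⟩ hxF (fun h => hxE h.2)
    exact hvn ⟨hv, hE3 u hu.2 v (hF1 hv) huv⟩
  have hFD : F ⊆ D := by
    by_cases hne : ∃ z ∈ F, z ∈ D
    · obtain ⟨z, hzF, hzD⟩ := hne
      intro y hy
      by_contra hyD
      obtain ⟨u, hu, v, hv, hvn, huv⟩ := aux_boundary H hF2 (T := F ∩ D) Set.inter_subset_left
        (x := z) (y := y) ⟨hzF, hzD⟩ hy (fun h => hyD h.2)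
      exact hvn ⟨hv, hcl u hu.2 v ⟨(hF1 hv).1, fun h => haF (h ▸ hv)⟩ huv⟩
    · push Not at hne
      have h1 : (H.induce (M \ D)).Connected := aux_diff H hM ha haD (fun z hz => (hD hz).1)
        (fun u hu v hv hva => hcl u hu v ⟨hv, hva⟩)
      obtain ⟨u, hu, v, hv, hvn, huv⟩ := aux_boundary H h1 (T := F)
        (fun z hz => ⟨(hF1 hz).1, hne z hz⟩) hxF (y := a) ⟨ha, haD⟩ haF
      exact absurd (hF3 u hu v ⟨hv.1, fun h => hv.2 (h ▸ ha'D)⟩ huv) hvn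
  have hlt2 : F.ncard < D.ncard := Set.ncard_lt_ncard
    ⟨hFD, fun h => (hF1 (h ha'D)).2 rfl⟩
  have := hmin' (j := (a', F)) ⟨ha'M, ⟨k, hk, hak⟩, hF1, hF2, hF3⟩ hlt2.le
  dsimp only at this
  omega
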